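/- Let d = 2 and let δ be the Weitzenböck derivation of F_2 with δ(x_1) = 0 and δ(x_2) = x_1. Then the algebra of constants F_2^δ = {w ∈ F_2 : δ(w) = 0} is generated as a unital K-algebra by the infinite set { x_1 } ∪ { [x_1,x_2]·(u_1v_2 − u_2v_1)^n : n ≥ 0 }, where the action of u_1v_2 − u_2v_1 on w ∈ F_2' is given by w·(u_1v_2 − u_2v_1) = x_1[w,x_2] − x_2[w,x_1]. -/

import Mathlib

noncomputable section

/-- The metabelian relation on the free associative algebra:
products of two commutators are identified with zero. -/
def MetabRel (K : Type*) [CommRing K] (d : ℕ) (p q : FreeAlgebra K (Fin d)) : Prop :=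
  q = 0 ∧ ∃ a b c e : FreeAlgebra K (Fin d), p = (a * b - b * a) * (c * e - e * c)

/-- The free metabelian associative algebra `F_d = A_d/(A_d')²`. -/
abbrev FreeMetab (K : Type*) [CommRing K] (d : ℕ) := RingQuot (MetabRel K d)

/-- The free generators `x_i` of `F_d`. -/
def xg (K : Type*) [CommRing K] (d : ℕ) (i : Fin d) : FreeMetab K d :=
  RingQuot.mkAlgHom K (MetabRel K d) (FreeAlgebra.ι K i)

/-- The commutator ideal `F_d'`: the two-sided ideal generated by all commutators. -/
def commIdeal (K : Type*) [CommRing K] (d : ℕ) : Ideal (FreeMetab K d) :=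
  Ideal.span {z | ∃ a f g b : FreeMetab K d, z = a * (f * g - g * f) * b}

/-- `K[U_d,V_d]`. -/
abbrev PolyUV (K : Type*) [CommRing K] (d : ℕ) := MvPolynomial (Fin d ⊕ Fin d) K

def uP (K : Type*) [CommRing K] (d : ℕ) (i : Fin d) : PolyUV K d := MvPolynomial.X (Sum.inl i)
def vP (K : Type*) [CommRing K] (d : ℕ) (i : Fin d) : PolyUV K d := MvPolynomial.X (Sum.inr i)

/-- Action of a monomial of `K[U_d,V_d]` on `F_d`, implementing
`f·u_i = x_i f` and `f·v_i = [f,x_i]` (on the commutator ideal all the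
individual operators commute, so the fixed order of composition is immaterial). -/
def monAct (K : Type*) [CommRing K] (d : ℕ) (m : (Fin d ⊕ Fin d) →₀ ℕ) :
    Module.End K (FreeMetab K d) :=
  (List.ofFn fun i : Fin d =>
      (LinearMap.mulLeft K (xg K d i) : Module.End K (FreeMetab K d)) ^ m (Sum.inl i)).prod *
  (List.ofFn fun i : Fin d =>
      (LinearMap.mulRight K (xg K d i) - LinearMap.mulLeft K (xg K d i) :
        Module.End K (FreeMetab K d)) ^ m (Sum.inr i)).prod

/-- The action of `K[U_d,V_d]` on the commutator ideal of `F_d`. -/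
def act (K : Type*) [CommRing K] (d : ℕ) (p : PolyUV K d) (w : FreeMetab K d) : FreeMetab K d :=
  ∑ m ∈ p.support, p.coeff m • (monAct K d m w)

/-- The action of `u₁v₂ - u₂v₁` on the commutator ideal of `F₂`:
`w ↦ x₁[w,x₂] - x₂[w,x₁]`. -/
def detStep (K : Type*) [CommRing K] (w : FreeMetab K 2) : FreeMetab K 2 :=
  xg K 2 0 * (w * xg K 2 1 - xg K 2 1 * w) - xg K 2 1 * (w * xg K 2 0 - xg K 2 0 * w)


open Polynomial in
/-- coefficientwise vanishing of `a ∂_Y + b ∂_Z` on `R[Z][Y]`. -/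
def KerCond {R : Type*} [CommRing R] (a b : R) (r : R[X][X]) : Prop :=
  ∀ k : ℕ, ((k : R[X]) + 1) * C a * r.coeff (k + 1) + C b * derivative (r.coeff k) = 0

section kernelLemma
open Polynomial

variable {R : Type*} [CommRing R] {a b : R}

lemma KerCond.add {r s : R[X][X]} (hr : KerCond a b r) (hs : KerCond a b s) :
    KerCond a b (r + s) := by
  intro k
  have h1 := hr k
  have h2 := hs k
  simp only [coeff_add, derivative_add]
  linear_combination h1 + h2

lemma KerCond.sub {r s : R[X][X]} (hr : KerCond a b r) (hs : KerCond a b s) :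
    KerCond a b (r - s) := by
  intro k
  have h1 := hr k
  have h2 := hs k
  simp only [coeff_sub, derivative_sub]
  linear_combination h1 - h2

lemma KerCond.const (g : R) : KerCond a b (C (C g)) := by
  intro k
  rcases k with _ | k <;> simp [coeff_C]

lemma KerCond.mulD {r : R[X][X]} (hr : KerCond a b r) :
    KerCond a b (r * (C (C a * X) - C (C b) * X)) := by
  intro k
  have e : r * (C (C a * X) - C (C b) * X) = r * C (C a * X) - r * C (C b) * X := by ring
  rw [e]
  rcases k with _ | k
  · have h := hr 0
    simp only [coeff_sub, coeff_mul_X, coeff_mul_C, coeff_mul_X_zero, sub_zero,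
      derivative_mul, derivative_C, derivative_X, Nat.cast_zero] at h ⊢
    linear_combination (C a * X) * h
  · have h := hr (k + 1)
    have h' := hr k
    simp only [coeff_sub, coeff_mul_X, coeff_mul_C, derivative_sub,
      derivative_mul, derivative_C, derivative_X, Nat.cast_add, Nat.cast_one] at h h' ⊢
    linear_combination (C a * X) * h - C b * h'

lemma KerCond.evalD (g : R[X]) :
    KerCond a b (g.eval₂ (C.comp C) (C (C a * X) - C (C b) * X)) := by
  induction g using Polynomial.induction_on with
  | C x => simpa using KerCond.const x
  | add p q hp hq => rw [eval₂_add]; exact hp.add hq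
  | monomial n x h =>
    have := h.mulD
    rw [pow_succ, ← mul_assoc, eval₂_mul_X]
    exact this

lemma evalD_coeff_zero (g : R[X]) :
    (g.eval₂ (C.comp C) (C (C a * X) - C (C b) * X) : R[X][X]).coeff 0 = g.comp (C a * X) := by
  have : ∀ r : R[X][X], r.coeff 0 = constantCoeff r := fun r => rfl
  rw [this, hom_eval₂, Polynomial.comp]
  congr 1
  · ext x; simp
  · simp

variable [IsDomain R] [CharZero R]

lemma KerCond.eq_zero (ha : a ≠ 0) {r : R[X][X]} (hr : KerCond a b r) (h0 : r.coeff 0 = 0) :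
    r = 0 := by
  ext1 k
  rw [coeff_zero]
  induction k with
  | zero => exact h0
  | succ k ih =>
    have h := hr k
    rw [ih] at h
    have hk : ((k : R[X]) + 1) ≠ 0 := by exact_mod_cast Nat.succ_ne_zero k
    simpa [hk, ha] using h

lemma KerCond.iter {r : R[X][X]} (hr : KerCond a b r) (k : ℕ) :
    C a ^ k * (k.factorial : R[X]) * r.coeff k = C (-b) ^ k * derivative^[k] (r.coeff 0) := by
  induction k with
  | zero => simp
  | succ k ih =>
    have h := hr k
    have ih' := congrArg derivative ih
    rw [Function.iterate_succ_apply', Nat.factorial_succ]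
    simp only [← C_pow, ← C_eq_natCast, derivative_mul, derivative_C] at ih'
    simp only [C_pow, C_eq_natCast] at ih'
    push_cast
    simp only [C_neg] at ih' ⊢
    linear_combination C a ^ k * (k.factorial : R[X]) * h - C b * ih'

lemma KerCond.dvd (ha : Prime a) (hab : ¬ a ∣ b) {r : R[X][X]} (hr : KerCond a b r) (n : ℕ) :
    a ^ n ∣ (r.coeff 0).coeff n := by
  have h := congrArg (fun p => coeff p 0) (hr.iter n)
  simp only [← C_pow, ← C_eq_natCast, mul_assoc, coeff_C_mul, coeff_iterate_derivative,
    zero_add, Nat.descFactorial_self, nsmul_eq_mul] at h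
  have hf : (n.factorial : R) ≠ 0 := by exact_mod_cast Nat.factorial_ne_zero n
  have h2 : a ^ n * (r.coeff n).coeff 0 = (-b) ^ n * (r.coeff 0).coeff n := by
    apply mul_left_cancel₀ hf
    linear_combination h
  refine ha.pow_dvd_of_dvd_mul_left n (a := (-b) ^ n) ?_ ⟨_, h2.symm⟩
  intro hd
  exact hab ((dvd_neg).1 (ha.dvd_of_dvd_pow hd))

lemma KerCond.exists_eval (ha : Prime a) (hab : ¬ a ∣ b) {r : R[X][X]} (hr : KerCond a b r) :
    ∃ g : R[X], r = g.eval₂ (C.comp C) (C (C a * X) - C (C b) * X) := by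
  choose c hc using hr.dvd ha hab
  let N := (r.coeff 0).natDegree
  refine ⟨∑ n ∈ Finset.range (N + 1), monomial n (c n), ?_⟩
  rw [← sub_eq_zero]
  refine (hr.sub (KerCond.evalD _)).eq_zero ha.ne_zero ?_
  rw [coeff_sub, evalD_coeff_zero, sub_eq_zero]
  ext n
  rw [comp_C_mul_X_coeff, finsetSum_coeff]
  simp only [coeff_monomial, Finset.sum_ite_eq', Finset.mem_range]
  split_ifs with h
  · rw [hc, mul_comm]
  · rw [coeff_eq_zero_of_natDegree_lt (by omega), zero_mul]

end kernelLemma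

section mv
open MvPolynomial

variable (K : Type*) [Field K]

abbrev PP := MvPolynomial (Fin 4) K

/-- `∂ a₂ = a₁`, `∂ b₂ = b₁` in `K[a₁,a₂,b₁,b₂]`. -/
def dP : Derivation K (PP K) (PP K) := mkDerivation K ![0, X 0, 0, X 2]

abbrev RR := MvPolynomial (Fin 2) K

def thetaP : PP K →ₐ[K] Polynomial (Polynomial (RR K)) :=
  aeval ![Polynomial.C (Polynomial.C (X 0)), Polynomial.X,
    Polynomial.C (Polynomial.C (X 1)), Polynomial.C Polynomial.X]

def baseP : RR K →ₐ[K] PP K := aeval ![X 0, X 2]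

def psiP : Polynomial (Polynomial (RR K)) →+* PP K :=
  Polynomial.eval₂RingHom (Polynomial.eval₂RingHom (baseP K).toRingHom (X 3)) (X 1)

lemma psiP_C (x : RR K) : psiP K (Polynomial.C (Polynomial.C x)) = baseP K x := by
  simp only [psiP, Polynomial.coe_eval₂RingHom, Polynomial.eval₂_C]
  rfl

lemma psiP_Y : psiP K Polynomial.X = X 1 := by
  simp only [psiP, Polynomial.coe_eval₂RingHom, Polynomial.eval₂_X]

lemma psiP_Z : psiP K (Polynomial.C Polynomial.X) = X 3 := by
  simp only [psiP, Polynomial.coe_eval₂RingHom, Polynomial.eval₂_C, Polynomial.eval₂_X]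

lemma theta_0 : thetaP K (X 0) = Polynomial.C (Polynomial.C (X 0)) := by simp [thetaP]
lemma theta_1 : thetaP K (X 1) = Polynomial.X := by simp [thetaP]
lemma theta_2 : thetaP K (X 2) = Polynomial.C (Polynomial.C (X 1)) := by simp [thetaP]
lemma theta_3 : thetaP K (X 3) = Polynomial.C Polynomial.X := by simp [thetaP]
lemma base_0 : baseP K (X 0) = X 0 := by simp [baseP]
lemma base_1 : baseP K (X 1) = X 2 := by simp [baseP]
lemma dP_0 : dP K (X 0) = 0 := by simp [dP, mkDerivation_X]
lemma dP_1 : dP K (X 1) = X 0 := by simp [dP, mkDerivation_X]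
lemma dP_2 : dP K (X 2) = 0 := by simp [dP, mkDerivation_X]
lemma dP_3 : dP K (X 3) = X 2 := by simp [dP, mkDerivation_X]

lemma psi_theta (p : PP K) : psiP K (thetaP K p) = p := by
  induction p using MvPolynomial.induction_on with
  | C x =>
    have h1 : thetaP K (C x) = Polynomial.C (Polynomial.C (C x)) := by
      rw [thetaP, aeval_C]; rfl
    have h2 : baseP K (C x) = C x := by rw [baseP, aeval_C]; rfl
    exact (congrArg _ h1).trans ((psiP_C K _).trans h2)
  | add p q hp hq => rw [map_add, RingHom.map_add, hp, hq]
  | mul_X p i h =>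
    rw [map_mul, RingHom.map_mul, h]
    refine congrArg (p * ·) ?_
    fin_cases i
    · exact (congrArg _ (theta_0 K)).trans ((psiP_C K _).trans (base_0 K))
    · exact (congrArg _ (theta_1 K)).trans (psiP_Y K)
    · exact (congrArg _ (theta_2 K)).trans ((psiP_C K _).trans (base_1 K))
    · exact (congrArg _ (theta_3 K)).trans (psiP_Z K)

lemma theta_dP (p : PP K) (k : ℕ) : (thetaP K (dP K p)).coeff k =
    ((k : Polynomial (RR K)) + 1) * Polynomial.C (X 0) * (thetaP K p).coeff (k + 1)
      + Polynomial.C (X 1) * Polynomial.derivative ((thetaP K p).coeff k) := by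
  induction p using MvPolynomial.induction_on generalizing k with
  | C x =>
    rw [← MvPolynomial.algebraMap_eq, AlgHom.commutes, Derivation.map_algebraMap]
    rcases k with _ | k <;> simp [Polynomial.algebraMap_apply, Polynomial.coeff_C]
  | add p q hp hq => simp only [map_add, Polynomial.coeff_add, hp, hq]; ring
  | mul_X p i h =>
    have hl : thetaP K (dP K (p * X i)) = thetaP K p * thetaP K (dP K (X i))
        + thetaP K (dP K p) * thetaP K (X i) := by
      rw [Derivation.leibniz]; simp only [smul_eq_mul, map_add, map_mul]; ring
    rw [hl, map_mul]
    have e0 := theta_0 K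
    have e1 := theta_1 K
    have e2 := theta_2 K
    have e3 := theta_3 K
    have d0 := dP_0 K
    have d1 := dP_1 K
    have d2 := dP_2 K
    have d3 := dP_3 K
    fin_cases i
    · simp only [Fin.zero_eta, e0, d0, map_zero, mul_zero, zero_add, Polynomial.coeff_mul_C, h,
        Polynomial.derivative_mul, Polynomial.derivative_C]
      ring
    · simp only [Fin.mk_one, e1, d1, e0, Polynomial.coeff_add, Polynomial.coeff_mul_C]
      rcases k with _ | k
      · simp only [Polynomial.coeff_mul_X_zero, Polynomial.coeff_mul_X, map_zero]
        push_cast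
        ring
      · simp only [Polynomial.coeff_mul_X, h]
        push_cast
        ring
    · simp only [Fin.reduceFinMk, e2, d2, map_zero, mul_zero, zero_add, Polynomial.coeff_mul_C, h,
        Polynomial.derivative_mul, Polynomial.derivative_C]
      ring
    · simp only [Fin.reduceFinMk, e3, d3, e2, Polynomial.coeff_add, Polynomial.coeff_mul_C, h,
        Polynomial.derivative_mul, Polynomial.derivative_X]
      ring

def DD : PP K := X 0 * X 3 - X 2 * X 1

lemma dP_DD : dP K (DD K) = 0 := by
  have d0 := dP_0 K
  have d1 := dP_1 K
  have d2 := dP_2 K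
  have d3 := dP_3 K
  simp only [DD, map_sub, Derivation.leibniz, d0, d1, d2, d3, smul_eq_mul]
  ring

lemma ker_dP [CharZero K] (p : PP K) (h : dP K p = 0) :
    ∃ g : Polynomial (RR K), p = g.eval₂ (baseP K).toRingHom (DD K) := by
  have hk : KerCond (X 0 : RR K) (X 1) (thetaP K p) := by
    intro k
    rw [← theta_dP, h]; simp
  have ha : Prime (X 0 : RR K) := X_prime
  have hab : ¬ (X 0 : RR K) ∣ X 1 := by
    rw [X_dvd_X]; simp
  obtain ⟨g, hg⟩ := hk.exists_eval ha hab
  refine ⟨g, ?_⟩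
  rw [← psi_theta K p, hg, Polynomial.hom_eval₂]
  congr 1
  · ext x
    · exact congrArg _ (psiP_C K _)
    · exact congrArg _ (psiP_C K _)
  · have h3 : ∀ s t, psiP K (s - t) + psiP K t = psiP K s := fun s t => by
      rw [← RingHom.map_add]
      exact congrArg _ (sub_add_cancel s t)
    rw [eq_sub_of_add_eq (h3 _ _), Polynomial.C_mul, RingHom.map_mul, RingHom.map_mul,
      psiP_C, psiP_C, psiP_Z, psiP_Y, base_0, base_1, DD]

end mv

lemma ring_id1 {A : Type*} [Ring A] (f g h s t : A) : (f * g - g * f) * h * (s * t - t * s)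
      = (f * g - g * f) * (h * s * t - t * (h * s))
        - (f * g - g * f) * (h * t - t * h) * s := by noncomm_ring

lemma ring_id2 {A : Type*} [Ring A] (f g h c : A) :
    f * g * h * c - g * f * h * c = (f * g - g * f) * h * c := by noncomm_ring

lemma ring_id3 {A : Type*} [Ring A] (f g h c : A) :
    c * (h * f * g) - c * (h * g * f) = c * h * (f * g - g * f) := by noncomm_ring

lemma ring_id4 {A : Type*} [Ring A] (x y z : A) : x * (z * y) - z * y * x
      = (x * z - z * x) * y + z * (x * y - y * x) := by noncomm_ring

section metab
variable (K : Type*) [Field K]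

abbrev FF := FreeMetab K 2
abbrev xx : FF K := xg K 2 0
abbrev yy : FF K := xg K 2 1
def cc : FF K := xx K * yy K - yy K * xx K

lemma comm_mul_comm (f g s t : FF K) : (f * g - g * f) * (s * t - t * s) = 0 := by
  obtain ⟨f, rfl⟩ := RingQuot.mkAlgHom_surjective K (MetabRel K 2) f
  obtain ⟨g, rfl⟩ := RingQuot.mkAlgHom_surjective K (MetabRel K 2) g
  obtain ⟨s, rfl⟩ := RingQuot.mkAlgHom_surjective K (MetabRel K 2) s
  obtain ⟨t, rfl⟩ := RingQuot.mkAlgHom_surjective K (MetabRel K 2) t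
  have h := RingQuot.mkAlgHom_rel K (s := MetabRel K 2)
    (x := (f * g - g * f) * (s * t - t * s)) (y := 0) ⟨rfl, f, g, s, t, rfl⟩
  simpa only [map_mul, map_sub, map_zero] using h

lemma comm_mid_comm (f g h s t : FF K) : (f * g - g * f) * h * (s * t - t * s) = 0 := by
  have h1 := comm_mul_comm K f g (h * s) t
  have h2 := comm_mul_comm K f g h t
  have e : (f * g - g * f) * h * (s * t - t * s)
      = (f * g - g * f) * (h * s * t - t * (h * s))
        - (f * g - g * f) * (h * t - t * h) * s := ring_id1 f g h s t
  rw [e, h1, h2]; simp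

/-- Induction on `F₂`. -/
lemma FF.induction {P : FF K → Prop} (h0 : ∀ k : K, P (algebraMap K _ k))
    (hx : P (xx K)) (hy : P (yy K)) (hm : ∀ a b, P a → P b → P (a * b))
    (ha : ∀ a b, P a → P b → P (a + b)) (w : FF K) : P w := by
  obtain ⟨f, rfl⟩ := RingQuot.mkAlgHom_surjective K (MetabRel K 2) w
  induction f using FreeAlgebra.induction with
  | grade0 r => rw [AlgHom.commutes]; exact h0 r
  | grade1 i => fin_cases i; exacts [hx, hy]
  | mul a b iha ihb => rw [map_mul]; exact hm _ _ iha ihb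
  | add a b iha ihb => rw [map_add]; exact ha _ _ iha ihb

/-! ### the map φ from polynomials to the commutator ideal -/

def phiM (m : Fin 4 →₀ ℕ) : FF K :=
  xx K ^ m 0 * yy K ^ m 1 * cc K * (xx K ^ m 2 * yy K ^ m 3)

def phi : PP K →ₗ[K] FF K := (MvPolynomial.basisMonomials (Fin 4) K).constr K (phiM K)

lemma phi_monomial (m : Fin 4 →₀ ℕ) : phi K (MvPolynomial.monomial m 1) = phiM K m := by
  have := (MvPolynomial.basisMonomials (Fin 4) K).constr_basis K (phiM K) m
  rwa [MvPolynomial.coe_basisMonomials] at this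

lemma phi_one : phi K 1 = cc K := by
  have := phi_monomial K 0
  simpa [phiM] using this

/-- To check that two linear maps agree on `PP`. -/
lemma phi_mulX_aux (i : Fin 4) (T : FF K →ₗ[K] FF K)
    (h : ∀ m, phiM K (m + Finsupp.single i 1) = T (phiM K m)) (p : PP K) :
    phi K (p * MvPolynomial.X i) = T (phi K p) := by
  induction p using MvPolynomial.induction_on' with
  | monomial m a =>
    have : (MvPolynomial.monomial m a : PP K) = a • MvPolynomial.monomial m 1 := by
      rw [MvPolynomial.smul_monomial, smul_eq_mul, mul_one]
    rw [this, smul_mul_assoc, map_smul, map_smul, map_smul, phi_monomial, ← h,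
      ← phi_monomial, MvPolynomial.X, MvPolynomial.monomial_mul, one_mul]
  | add p q hp hq => rw [add_mul, map_add, map_add, map_add, hp, hq]

lemma left_comm_c (f g h : FF K) : f * g * h * cc K = g * f * h * cc K := by
  rw [← sub_eq_zero]
  exact (ring_id2 f g h (cc K)).trans (comm_mid_comm K f g h (xx K) (yy K))

lemma right_comm_c (f g h : FF K) : cc K * (h * f * g) = cc K * (h * g * f) := by
  rw [← sub_eq_zero]
  exact (ring_id3 f g h (cc K)).trans (comm_mid_comm K (xx K) (yy K) h f g)

lemma phi_X0 (p : PP K) : phi K (p * MvPolynomial.X 0) = xx K * phi K p := by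
  refine phi_mulX_aux K 0 (LinearMap.mulLeft K (xx K)) (fun m => ?_) p
  simp [phiM, pow_succ', mul_assoc]

lemma phi_X1 (p : PP K) : phi K (p * MvPolynomial.X 1) = yy K * phi K p := by
  refine phi_mulX_aux K 1 (LinearMap.mulLeft K (yy K)) (fun m => ?_) p
  have h := left_comm_c K (xx K ^ m 0) (yy K) (yy K ^ m 1)
  simp only [phiM, LinearMap.mulLeft_apply, Finsupp.add_apply, Finsupp.single_apply]
  simp only [← mul_assoc]
  rw [← h]
  simp [pow_succ', mul_assoc]

lemma phi_X2 (p : PP K) : phi K (p * MvPolynomial.X 2) = phi K p * xx K := by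
  refine phi_mulX_aux K 2 (LinearMap.mulRight K (xx K)) (fun m => ?_) p
  have h := right_comm_c K (yy K ^ m 3) (xx K) (xx K ^ m 2)
  simp only [phiM, LinearMap.mulRight_apply, Finsupp.add_apply, Finsupp.single_apply]
  rw [mul_assoc, mul_assoc _ _ (xx K), mul_assoc _ (cc K) (_ * xx K), h]
  simp [pow_succ, mul_assoc]

lemma phi_X3 (p : PP K) : phi K (p * MvPolynomial.X 3) = phi K p * yy K := by
  refine phi_mulX_aux K 3 (LinearMap.mulRight K (yy K)) (fun m => ?_) p
  simp [phiM, pow_succ, mul_assoc]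

/-! ### the triangular representation -/

open MvPolynomial in
def repA : FreeAlgebra K (Fin 2) →ₐ[K] Matrix (Fin 2) (Fin 2) (PP K) :=
  FreeAlgebra.lift K ![!![X 0, 0; 0, X 2], !![X 1, 1; 0, X 3]]

lemma repA_lower (f : FreeAlgebra K (Fin 2)) : repA K f 1 0 = 0 := by
  induction f using FreeAlgebra.induction with
  | grade0 r => rw [AlgHom.commutes]; simp [Matrix.algebraMap_matrix_apply]
  | grade1 i => fin_cases i <;> simp [repA]
  | mul a b iha ihb => rw [map_mul, Matrix.mul_apply, Fin.sum_univ_two, iha, ihb]; simp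
  | add a b iha ihb => rw [map_add, Matrix.add_apply, iha, ihb]; simp

lemma repA_rel ⦃p q : FreeAlgebra K (Fin 2)⦄ (h : MetabRel K 2 p q) : repA K p = repA K q := by
  obtain ⟨rfl, a, b, c, e, rfl⟩ := h
  have ha := repA_lower K a
  have hb := repA_lower K b
  have hc := repA_lower K c
  have he := repA_lower K e
  simp only [map_mul, map_sub, map_zero]
  ext i j : 2
  simp only [Matrix.mul_apply, Fin.sum_univ_two, Matrix.sub_apply, Matrix.zero_apply]
  fin_cases i <;> fin_cases j <;> simp [ha, hb, hc, he] <;> ring_nf <;> simp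

def rep : FF K →ₐ[K] Matrix (Fin 2) (Fin 2) (PP K) :=
  RingQuot.liftAlgHom K ⟨repA K, repA_rel K⟩

lemma rep_x : rep K (xx K) = !![MvPolynomial.X 0, 0; 0, MvPolynomial.X 2] := by
  rw [rep, xx, xg, RingQuot.liftAlgHom_mkAlgHom_apply]; simp [repA]

lemma rep_y : rep K (yy K) = !![MvPolynomial.X 1, 1; 0, MvPolynomial.X 3] := by
  rw [rep, yy, xg, RingQuot.liftAlgHom_mkAlgHom_apply]; simp [repA]

def kap : PP K := MvPolynomial.X 0 - MvPolynomial.X 2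

lemma kap_ne : kap K ≠ 0 := by
  rw [kap, sub_ne_zero]
  intro h
  exact absurd (MvPolynomial.X_injective h) (by decide)

lemma rep_phi (p : PP K) : rep K (phi K p) = !![0, p * kap K; 0, 0] := by
  induction p using MvPolynomial.induction_on with
  | C k =>
    have : (MvPolynomial.C k : PP K) = k • 1 := by
      rw [MvPolynomial.smul_eq_C_mul, mul_one]
    rw [this, map_smul, phi_one, cc, map_smul, map_sub, map_mul, map_mul, rep_x, rep_y]
    ext i j : 2
    fin_cases i <;> fin_cases j <;> simp [kap, mul_comm]
  | add p q hp hq => rw [map_add, map_add, hp, hq]; simp [add_mul]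
  | mul_X p i h =>
    fin_cases i
    · change rep K (phi K (p * MvPolynomial.X 0)) = !![0, p * MvPolynomial.X 0 * kap K; 0, 0]
      rw [phi_X0, map_mul, h, rep_x]; simp; ring
    · change rep K (phi K (p * MvPolynomial.X 1)) = !![0, p * MvPolynomial.X 1 * kap K; 0, 0]
      rw [phi_X1, map_mul, h, rep_y]; simp; ring
    · change rep K (phi K (p * MvPolynomial.X 2)) = !![0, p * MvPolynomial.X 2 * kap K; 0, 0]
      rw [phi_X2, map_mul, h, rep_x, mul_right_comm]
      ext i j : 2
      fin_cases i <;> fin_cases j <;> simp [Matrix.mul_apply]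
    · change rep K (phi K (p * MvPolynomial.X 3)) = !![0, p * MvPolynomial.X 3 * kap K; 0, 0]
      rw [phi_X3, map_mul, h, rep_y, mul_right_comm]
      ext i j : 2
      fin_cases i <;> fin_cases j <;> simp [Matrix.mul_apply]

lemma phi_inj (p : PP K) (h : phi K p = 0) : p = 0 := by
  have h1 := rep_phi K p
  rw [h, map_zero] at h1
  have h2 := congrFun (congrFun h1 0) 1
  simpa [kap_ne] using h2.symm

/-! ### the ideal `N = range φ` and the normal form modulo `N` -/

def NN : Submodule K (FF K) := LinearMap.range (phi K)

lemma NN_both (z : FF K) : ∀ n ∈ NN K, z * n ∈ NN K ∧ n * z ∈ NN K := by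
  induction z using FF.induction with
  | h0 k =>
    intro n hn
    rw [← Algebra.commutes, ← Algebra.smul_def]
    exact ⟨(NN K).smul_mem k hn, (NN K).smul_mem k hn⟩
  | hx =>
    rintro n ⟨p, rfl⟩
    exact ⟨⟨_, phi_X0 K p⟩, ⟨_, phi_X2 K p⟩⟩
  | hy =>
    rintro n ⟨p, rfl⟩
    exact ⟨⟨_, phi_X1 K p⟩, ⟨_, phi_X3 K p⟩⟩
  | hm a b iha ihb =>
    intro n hn
    rw [mul_assoc, ← mul_assoc n]
    exact ⟨(iha _ (ihb n hn).1).1, (ihb _ (iha n hn).2).2⟩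
  | ha a b iha ihb =>
    intro n hn
    rw [add_mul, mul_add]
    exact ⟨add_mem (iha n hn).1 (ihb n hn).1, add_mem (iha n hn).2 (ihb n hn).2⟩

lemma cc_mem : cc K ∈ NN K := ⟨1, phi_one K⟩

lemma comm_pow_mem (j : ℕ) : xx K * yy K ^ j - yy K ^ j * xx K ∈ NN K := by
  induction j with
  | zero => simp
  | succ j ih =>
    have e : xx K * yy K ^ (j + 1) - yy K ^ (j + 1) * xx K
      = (xx K * yy K ^ j - yy K ^ j * xx K) * yy K + yy K ^ j * cc K := by
      rw [pow_succ]; exact ring_id4 _ _ _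
    rw [e]
    exact add_mem (NN_both K _ _ ih).2 (NN_both K _ _ (cc_mem K)).1

open Polynomial in
def piA : FreeAlgebra K (Fin 2) →ₐ[K] K[X][X] := FreeAlgebra.lift K ![C X, X]

lemma piA_rel ⦃p q : FreeAlgebra K (Fin 2)⦄ (h : MetabRel K 2 p q) : piA K p = piA K q := by
  obtain ⟨rfl, a, b, c, e, rfl⟩ := h
  simp only [map_mul, map_sub, map_zero]
  ring

open Polynomial in
def piF : FF K →ₐ[K] K[X][X] := RingQuot.liftAlgHom K ⟨piA K, piA_rel K⟩

open Polynomial in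
lemma piF_x : piF K (xx K) = C X := by
  rw [piF, xx, xg, RingQuot.liftAlgHom_mkAlgHom_apply]; simp [piA]

open Polynomial in
lemma piF_y : piF K (yy K) = X := by
  rw [piF, yy, xg, RingQuot.liftAlgHom_mkAlgHom_apply]; simp [piA]

open Polynomial in
/-- ordered section -/
def ss (q : K[X][X]) : FF K := q.eval₂ (aeval (R := K) (xx K)).toRingHom (yy K)

open Polynomial in
lemma ss_X (q : K[X][X]) : ss K (q * X) = ss K q * yy K := by
  rw [ss, eval₂_mul_X]; rfl

open Polynomial in
lemma ss_add (q r : K[X][X]) : ss K (q + r) = ss K q + ss K r := by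
  rw [ss, eval₂_add]; rfl

open Polynomial in
lemma ss_CX (q : K[X][X]) : ss K (q * C X) - ss K q * xx K ∈ NN K := by
  induction q using Polynomial.induction_on' with
  | add p q hp hq =>
    rw [add_mul, ss_add, ss_add, add_mul, add_sub_add_comm]
    exact add_mem hp hq
  | monomial n f =>
    rw [monomial_mul_C, ss, ss, eval₂_monomial, eval₂_monomial, map_mul]
    have hX : (aeval (R := K) (xx K)).toRingHom X = xx K := aeval_X _
    have e := (NN_both K ((aeval (R := K) (xx K)).toRingHom f) _ (comm_pow_mem K n)).1
    rw [hX]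
    simpa only [mul_sub, mul_assoc] using e

open Polynomial in
lemma ss_smul (k : K) (q : K[X][X]) : ss K (k • q) = k • ss K q := by
  induction q using Polynomial.induction_on' with
  | add p q hp hq => rw [smul_add, ss_add, ss_add, smul_add, hp, hq]
  | monomial n f =>
    rw [smul_monomial, ss, ss, eval₂_monomial, eval₂_monomial]
    have : (aeval (R := K) (xx K)).toRingHom (k • f)
      = k • (aeval (R := K) (xx K)).toRingHom f := map_smul (aeval (R := K) (xx K)) k f
    rw [this, smul_mul_assoc]

lemma nf_aux (z : FF K) : ∀ w, ss K (piF K w) - w ∈ NN K →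
    ss K (piF K (w * z)) - w * z ∈ NN K := by
  induction z using FF.induction with
  | h0 k =>
    intro w hw
    rw [← Algebra.commutes, ← Algebra.smul_def, map_smul, ss_smul]
    have h := (NN K).smul_mem k hw
    have e : k • (ss K (piF K w) - w) = k • ss K (piF K w) - k • w := smul_sub _ _ _
    rwa [e] at h
  | hx =>
    intro w hw
    rw [map_mul, piF_x]
    have h1 := ss_CX K (piF K w)
    have h2 := (NN_both K (xx K) _ hw).2
    have := add_mem h1 h2
    rw [sub_mul] at this
    simpa using this
  | hy =>
    intro w hw
    rw [map_mul, piF_y, ss_X, ← sub_mul]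
    exact (NN_both K (yy K) _ hw).2
  | hm a b iha ihb =>
    intro w hw
    rw [← mul_assoc]
    exact ihb _ (iha _ hw)
  | ha a b iha ihb =>
    intro w hw
    rw [mul_add, map_add, ss_add, add_sub_add_comm]
    exact add_mem (iha _ hw) (ihb _ hw)

lemma nf (w : FF K) : ss K (piF K w) - w ∈ NN K := by
  have := nf_aux K w 1 (by simp [ss])
  simpa using this

/-! ### the derivation -/

variable {K}
lemma d_one (δ : FF K →ₗ[K] FF K) (hleib : ∀ a b : FF K, δ (a * b) = δ a * b + a * δ b)
    : δ 1 = 0 := by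
  have := hleib 1 1
  simpa using this

lemma d_alg (δ : FF K →ₗ[K] FF K) (hleib : ∀ a b : FF K, δ (a * b) = δ a * b + a * δ b)
    (k : K) : δ (algebraMap K _ k) = 0 := by
  rw [Algebra.algebraMap_eq_smul_one, map_smul, d_one δ hleib, smul_zero]

lemma d_cc (δ : FF K →ₗ[K] FF K) (hleib : ∀ a b : FF K, δ (a * b) = δ a * b + a * δ b)
    (h1 : δ (xx K) = 0) (h2 : δ (yy K) = xx K) : δ (cc K) = 0 := by
  rw [cc, map_sub, hleib, hleib, h1, h2]; simp

lemma d_phi (δ : FF K →ₗ[K] FF K) (hleib : ∀ a b : FF K, δ (a * b) = δ a * b + a * δ b)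
    (h1 : δ (xx K) = 0) (h2 : δ (yy K) = xx K) (p : PP K) : δ (phi K p) = phi K (dP K p) := by
  induction p using MvPolynomial.induction_on with
  | C k =>
    have : (MvPolynomial.C k : PP K) = k • 1 := by
      rw [MvPolynomial.smul_eq_C_mul, mul_one]
    rw [this, map_smul, phi_one, map_smul, d_cc δ hleib h1 h2, Derivation.map_smul]
    simp
  | add p q hp hq => simp only [map_add, hp, hq]
  | mul_X p i h =>
    have key : ∀ i, dP K (p * MvPolynomial.X i)
      = p * dP K (MvPolynomial.X i) + dP K p * MvPolynomial.X i := by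
      intro i
      rw [Derivation.leibniz]; simp only [smul_eq_mul]; ring
    rw [key, map_add]
    fin_cases i
    · change δ (phi K (p * MvPolynomial.X 0)) = phi K (p * dP K (MvPolynomial.X 0))
        + phi K (dP K p * MvPolynomial.X 0)
      rw [dP_0, phi_X0, phi_X0, hleib, h, h1]; simp
    · change δ (phi K (p * MvPolynomial.X 1)) = phi K (p * dP K (MvPolynomial.X 1))
        + phi K (dP K p * MvPolynomial.X 1)
      rw [dP_1, phi_X1, phi_X1, phi_X0, hleib, h, h2]
    · change δ (phi K (p * MvPolynomial.X 2)) = phi K (p * dP K (MvPolynomial.X 2))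
        + phi K (dP K p * MvPolynomial.X 2)
      rw [dP_2, phi_X2, phi_X2, hleib, h, h1]; simp
    · change δ (phi K (p * MvPolynomial.X 3)) = phi K (p * dP K (MvPolynomial.X 3))
        + phi K (dP K p * MvPolynomial.X 3)
      rw [dP_3, phi_X3, phi_X3, phi_X2, hleib, h, h2, add_comm]

open Polynomial in
lemma pi_d (δ : FF K →ₗ[K] FF K) (hleib : ∀ a b : FF K, δ (a * b) = δ a * b + a * δ b)
    (h1 : δ (xx K) = 0) (h2 : δ (yy K) = xx K) (w : FF K) : piF K (δ w) = C X * derivative (piF K w) := by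
  induction w using FF.induction with
  | h0 k =>
    rw [d_alg δ hleib, AlgHom.commutes, Polynomial.algebraMap_apply]; simp
  | hx => rw [h1, piF_x]; simp
  | hy => rw [h2, piF_x, piF_y]; simp
  | hm a b iha ihb =>
    rw [hleib, map_add, map_mul, map_mul, map_mul, iha, ihb, derivative_mul]; ring
  | ha a b iha ihb => simp only [map_add, iha, ihb]; ring

open Polynomial in
lemma pi_const (δ : FF K →ₗ[K] FF K) (hleib : ∀ a b : FF K, δ (a * b) = δ a * b + a * δ b)
    (h1 : δ (xx K) = 0) (h2 : δ (yy K) = xx K) [CharZero K] (w : FF K) (hw : δ w = 0) : ∃ f : K[X], piF K w = C f := by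
  have h := pi_d δ hleib h1 h2 w
  rw [hw, map_zero] at h
  have h' : derivative (piF K w) = 0 := by
    rcases mul_eq_zero.1 h.symm with h | h
    · simp at h
    · exact h
  exact ⟨_, eq_C_of_natDegree_eq_zero (derivative_eq_zero.1 h')⟩

lemma detStep_phi (p : PP K) : detStep K (phi K p) = phi K (p * DD K) := by
  have e : p * DD K = p * MvPolynomial.X 3 * MvPolynomial.X 0
      - p * MvPolynomial.X 1 * MvPolynomial.X 0 - (p * MvPolynomial.X 2 * MvPolynomial.X 1
      - p * MvPolynomial.X 0 * MvPolynomial.X 1) := by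
    rw [DD]; ring
  rw [e, map_sub, map_sub, map_sub, phi_X0, phi_X0, phi_X1, phi_X1, phi_X1, phi_X0, phi_X2, phi_X3,
    detStep]
  simp only [mul_sub]

lemma detStep_iter (n : ℕ) : (detStep K)^[n] (cc K) = phi K (DD K ^ n) := by
  induction n with
  | zero => simp [phi_one]
  | succ n ih => rw [Function.iterate_succ_apply', ih, detStep_phi, pow_succ]

lemma base_mem (A : Subalgebra K (FF K)) (hx : xx K ∈ A) (q : PP K) (hq : phi K q ∈ A)
    (g : RR K) : phi K (baseP K g * q) ∈ A := by
  induction g using MvPolynomial.induction_on with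
  | C k =>
    have h2 : baseP K (MvPolynomial.C k) = MvPolynomial.C k := by
      rw [baseP, MvPolynomial.aeval_C]; rfl
    rw [h2, ← MvPolynomial.smul_eq_C_mul, map_smul]
    exact A.smul_mem hq k
  | add p q hp hq => rw [map_add, add_mul, map_add]; exact add_mem hp hq
  | mul_X p i h =>
    rw [map_mul (baseP K), mul_right_comm]
    fin_cases i
    · change phi K (_ * baseP K (MvPolynomial.X 0)) ∈ A
      rw [base_0, phi_X0]; exact mul_mem hx h
    · change phi K (_ * baseP K (MvPolynomial.X 1)) ∈ A
      rw [base_1, phi_X2]; exact mul_mem h hx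

lemma eval_mem (A : Subalgebra K (FF K)) (hx : xx K ∈ A) (hD : ∀ n, phi K (DD K ^ n) ∈ A)
    (g : Polynomial (RR K)) : phi K (g.eval₂ (baseP K).toRingHom (DD K)) ∈ A := by
  induction g using Polynomial.induction_on' with
  | add p q hp hq => rw [Polynomial.eval₂_add, map_add]; exact add_mem hp hq
  | monomial n f => rw [Polynomial.eval₂_monomial]; exact base_mem A hx _ (hD n) f

end metab

/-- For `d = 2` and the Weitzenböck derivation with `δ(x₁) = 0`,
`δ(x₂) = x₁`, the algebra of constants `F₂^δ` is generated as a unital `K`-algebra by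
`{x₁} ∪ {[x₁,x₂]·(u₁v₂-u₂v₁)ⁿ : n ≥ 0}`. -/
theorem algebra_generators_d2
    (K : Type*) [Field K] [CharZero K]
    (δ : FreeMetab K 2 →ₗ[K] FreeMetab K 2)
    (hleib : ∀ a b : FreeMetab K 2, δ (a * b) = δ a * b + a * δ b)
    (h1 : δ (xg K 2 0) = 0) (h2 : δ (xg K 2 1) = xg K 2 0) :
    {w : FreeMetab K 2 | δ w = 0}
      = ↑(Algebra.adjoin K ({xg K 2 0} ∪
          Set.range fun n : ℕ =>
            (detStep K)^[n] (xg K 2 0 * xg K 2 1 - xg K 2 1 * xg K 2 0))) := by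
  change _ = (↑(Algebra.adjoin K ({xx K} ∪ Set.range fun n : ℕ => (detStep K)^[n] (cc K))) :
    Set (FF K))
  set A := Algebra.adjoin K ({xx K} ∪ Set.range fun n : ℕ => (detStep K)^[n] (cc K)) with hA
  have hx : xx K ∈ A := Algebra.subset_adjoin (Or.inl rfl)
  have hD : ∀ n, phi K (DD K ^ n) ∈ A := fun n =>
    Algebra.subset_adjoin (Or.inr ⟨n, detStep_iter n⟩)
  apply Set.Subset.antisymm
  · intro w hw
    have hw : δ w = 0 := hw
    obtain ⟨f, hf⟩ := pi_const δ hleib h1 h2 w hw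
    obtain ⟨p, hp⟩ := nf K w
    have hs : ss K (Polynomial.C f) = Polynomial.aeval (xx K) f := by
      rw [ss, Polynomial.eval₂_C]; rfl
    rw [hf, hs] at hp
    have hfA : ∀ f : Polynomial K, Polynomial.aeval (xx K) f ∈ A := fun f =>
      Algebra.adjoin_le (Set.singleton_subset_iff.2 hx) (Polynomial.aeval_mem_adjoin_singleton K (xx K))
    have hfd : ∀ f : Polynomial K, δ (Polynomial.aeval (xx K) f) = 0 := by
      intro f
      induction f using Polynomial.induction_on with
      | C k => rw [Polynomial.aeval_C, d_alg δ hleib]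
      | add p q hp hq => rw [map_add, map_add, hp, hq, add_zero]
      | monomial n k h =>
        rw [pow_succ, ← mul_assoc, map_mul, hleib, h, Polynomial.aeval_X, h1]; simp
    have hdp : phi K (dP K p) = 0 := by
      rw [← d_phi δ hleib h1 h2, hp, map_sub, hfd, hw, sub_zero]
    obtain ⟨g, hg⟩ := ker_dP K p (phi_inj K _ hdp)
    have hpA : phi K p ∈ A := by rw [hg]; exact eval_mem A hx hD g
    have : w = Polynomial.aeval (xx K) f - phi K p := by rw [hp]; simp
    rw [this]
    exact sub_mem (hfA f) hpA
  · intro w hw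
    change δ w = 0
    replace hw : w ∈ A := hw
    rw [hA] at hw
    induction hw using Algebra.adjoin_induction with
    | mem z hz =>
      rcases hz with hz | ⟨n, hz⟩
      · rw [Set.mem_singleton_iff.1 hz]; exact h1
      · rw [← hz]
        change δ ((detStep K)^[n] (cc K)) = 0
        rw [detStep_iter, d_phi δ hleib h1 h2, Derivation.leibniz_pow, dP_DD]
        simp
    | algebraMap k => exact d_alg δ hleib k
    | add a b _ _ iha ihb => rw [map_add, iha, ihb, add_zero]
    | mul a b _ _ iha ihb => rw [hleib, iha, ihb]; simp
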